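/- For every m ≥ 3 there exists a system of two real bivariate polynomials, the first having at most 3 monomial terms and the second at most m monomial terms, which has at least 2m − 1 isolated common roots in the open positive quadrant. -/

import Mathlib

open Filter Topology Set

namespace TrinomialCurve

/-- The abscissa of the point with ordinate `s` on the curve `x ^ 6 + 44 / 31 * y ^ 3 = y`. -/
noncomputable def abscissa (s : ℝ) : ℝ := Real.exp (Real.log (s - 44 / 31 * s ^ 3) / 6)

/-- The range of ordinates of the curve `x ^ 6 + 44 / 31 * y ^ 3 = y` in the positive quadrant. -/
noncomputable def ordinates : Set ℝ := Ioo 0 √(31 / 44)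

/-- The restriction to the curve of the polynomial with coefficients `d` and exponents `h`. -/
noncomputable def restriction {m : ℕ} (d : Fin m → ℝ) (h : Fin m → ℤ × ℤ) (s : ℝ) : ℝ :=
  ∑ i, d i * abscissa s ^ (h i).1 * s ^ (h i).2

lemma mem_ordinates {s : ℝ} : s ∈ ordinates ↔ 0 < s ∧ 44 / 31 * s ^ 2 < 1 := by
  unfold ordinates
  rw [mem_Ioo]
  refine and_congr_right fun h => ?_
  rw [Real.lt_sqrt h.le]
  constructor <;> intro h <;> linarith

lemma isOpen_ordinates : IsOpen ordinates := isOpen_Ioo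

lemma abscissa_pos (s : ℝ) : 0 < abscissa s := Real.exp_pos _

lemma sub_cube_pos {s : ℝ} (hs : s ∈ ordinates) : 0 < s - 44 / 31 * s ^ 3 := by
  obtain ⟨h0, h1⟩ := mem_ordinates.1 hs
  have := mul_pos h0 (sub_pos.2 h1)
  linarith

lemma abscissa_pow_six {s : ℝ} (hs : s ∈ ordinates) : abscissa s ^ 6 = s - 44 / 31 * s ^ 3 := by
  rw [abscissa, ← Real.exp_nat_mul]
  push_cast
  rw [mul_div_cancel₀ _ (by norm_num), Real.exp_log (sub_cube_pos hs)]

lemma log_abscissa {s : ℝ} (hs : s ∈ ordinates) :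
    6 * Real.log (abscissa s) = Real.log s + Real.log (1 - 44 / 31 * s ^ 2) := by
  obtain ⟨h0, h1⟩ := mem_ordinates.1 hs
  rw [abscissa, Real.log_exp, ← Real.log_mul h0.ne' (sub_pos.2 h1).ne']
  ring_nf

lemma mem_curve_iff {x y : ℝ} (hx : 0 < x) (hy : 0 < y) :
    x ^ 6 + 44 / 31 * y ^ 3 = y ↔ y ∈ ordinates ∧ x = abscissa y := by
  constructor
  · intro h
    have hy' : y ∈ ordinates := by
      rw [mem_ordinates]
      refine ⟨hy, ?_⟩
      by_contra! h'
      have := mul_le_mul_of_nonneg_left h' hy.le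
      have := pow_pos hx 6
      linarith
    refine ⟨hy', ?_⟩
    rw [← pow_left_inj₀ hx.le (abscissa_pos y).le (n := 6) (by norm_num), abscissa_pow_six hy']
    linarith
  · rintro ⟨h, rfl⟩
    rw [abscissa_pow_six h]
    ring

lemma analyticAt_abscissa {s : ℝ} (hs : s ∈ ordinates) : AnalyticAt ℝ abscissa s := by
  have h : AnalyticAt ℝ (fun s : ℝ => s - 44 / 31 * s ^ 3) s := by fun_prop
  exact ((h.log (sub_cube_pos hs)).div_const).rexp

lemma analyticOnNhd_restriction {m : ℕ} (d : Fin m → ℝ) (h : Fin m → ℤ × ℤ) :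
    AnalyticOnNhd ℝ (restriction d h) ordinates := by
  intro s hs
  unfold restriction
  refine Finset.analyticAt_fun_sum _ fun i _ => ?_
  exact (analyticAt_const.mul ((analyticAt_abscissa hs).zpow (abscissa_pos s).ne')).mul
    (analyticAt_id.zpow (mem_ordinates.1 hs).1.ne')

lemma gibbs_inequality {v w : ℝ} (hv : 0 < v) (hv1 : v < 1) (hw : 0 < w) (hw1 : w < 1)
    (hne : v ≠ w) :
    (1 - w) * Real.log (1 - v) + w * Real.log v < (1 - w) * Real.log (1 - w) + w * Real.log w := by
  have h1 : Real.log (v / w) < v / w - 1 :=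
    Real.log_lt_sub_one_of_pos (by positivity) (by rwa [Ne, div_eq_one_iff_eq hw.ne'])
  have h2 : Real.log ((1 - v) / (1 - w)) ≤ (1 - v) / (1 - w) - 1 :=
    Real.log_le_sub_one_of_pos (div_pos (by linarith) (by linarith))
  rw [Real.log_div hv.ne' hw.ne'] at h1
  rw [Real.log_div (by linarith) (by linarith)] at h2
  have h3 := mul_lt_mul_of_pos_left h1 hw
  have h4 := mul_le_mul_of_nonneg_left h2 (sub_pos.2 hw1).le
  have h5 : w * (v / w - 1) = v - w := by field_simp
  have h6 : (1 - w) * ((1 - v) / (1 - w) - 1) = w - v := by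
    have : 1 - w ≠ 0 := by linarith
    field_simp
    ring
  linarith

/-- Monomials peak, along the curve, at any prescribed point relative to finitely many others. -/
lemma exists_peaked_monomial {s₀ : ℝ} (hs₀ : s₀ ∈ ordinates) (P : Finset ℝ)
    (hP : ∀ s ∈ P, s ∈ ordinates ∧ s ≠ s₀) :
    ∃ a b : ℤ, ∀ s ∈ P, abscissa s ^ a * s ^ b < abscissa s₀ ^ a * s₀ ^ b := by
  let L : ℝ → ℝ → ℝ := fun r s =>
    6 * (1 - r) * Real.log (abscissa s) + (3 * r - 1) * Real.log s
  have hL : ∀ r, ∀ s ∈ ordinates, L r s = (1 - r) * Real.log (1 - 44 / 31 * s ^ 2) +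
      r * Real.log (44 / 31 * s ^ 2) - r * Real.log (44 / 31) := by
    intro r s hs
    have h0 := (mem_ordinates.1 hs).1
    have := log_abscissa hs
    rw [Real.log_mul (by norm_num) (by positivity), Real.log_pow]
    simp only [L]
    push_cast
    linear_combination (1 - r) * this
  have hev : ∀ᶠ r in 𝓝 (44 / 31 * s₀ ^ 2), ∀ s ∈ P, L r s < L r s₀ := by
    rw [eventually_all_finset]
    intro s hs
    obtain ⟨hsI, hne⟩ := hP s hs
    obtain ⟨h0, h1⟩ := mem_ordinates.1 hsI
    obtain ⟨k0, k1⟩ := mem_ordinates.1 hs₀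
    have hc : ∀ s, Continuous fun r => L r s := fun s => by fun_prop
    refine (hc s).continuousAt.eventually_lt (hc s₀).continuousAt ?_
    rw [hL _ s hsI, hL _ s₀ hs₀]
    have := gibbs_inequality (v := 44 / 31 * s ^ 2) (w := 44 / 31 * s₀ ^ 2)
      (by positivity) h1 (by positivity) k1 (by
        intro h
        have h' : s ^ 2 = s₀ ^ 2 := by linarith
        exact hne ((pow_left_inj₀ h0.le k0.le two_ne_zero).1 h'))
    linarith
  obtain ⟨U, hU, hUo, hmem⟩ := eventually_nhds_iff.1 hev
  obtain ⟨q, hq⟩ := Rat.denseRange_cast.exists_mem_open hUo ⟨_, hmem⟩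
  refine ⟨6 * (q.den - q.num), 3 * q.num - q.den, fun s hs => ?_⟩
  have key := hU q hq s hs
  have h0 := (mem_ordinates.1 (hP s hs).1).1
  have k0 := (mem_ordinates.1 hs₀).1
  have hden : (0 : ℝ) < q.den := by exact_mod_cast q.den_pos
  have hnum : (q : ℝ) * q.den = q.num := by exact_mod_cast q.mul_den_eq_num
  have hlog : ∀ s, 0 < s → Real.log (abscissa s ^ (6 * ((q.den : ℤ) - q.num)) *
      s ^ (3 * q.num - (q.den : ℤ))) = q.den * L q s := by
    intro s hs
    rw [Real.log_mul (zpow_pos (abscissa_pos s) _).ne' (zpow_pos hs _).ne', Real.log_zpow,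
      Real.log_zpow]
    simp only [L]
    push_cast
    rw [← hnum]
    ring
  rw [← Real.log_lt_log_iff (mul_pos (zpow_pos (abscissa_pos s) _) (zpow_pos h0 _))
    (mul_pos (zpow_pos (abscissa_pos s₀) _) (zpow_pos k0 _)), hlog s h0, hlog s₀ k0]
  exact mul_lt_mul_of_pos_left key hden

/-- The restriction to the curve alternates in sign, starting with a positive value, along some
increasing sequence of `n` ordinates. -/
def Alternates {m : ℕ} (d : Fin m → ℝ) (h : Fin m → ℤ × ℤ) (n : ℕ) : Prop :=
  ∃ t : ℕ → ℝ, (∀ i j, i < j → j < n → t i < t j) ∧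
    ∀ i < n, t i ∈ ordinates ∧ 0 < (-1) ^ i * restriction d h (t i)

lemma exists_lt_restriction_pos {m : ℕ} (d : Fin m → ℝ) (h : Fin m → ℤ × ℤ) {s : ℝ}
    (hs : s ∈ ordinates) (hpos : 0 < restriction d h s) :
    ∃ s' < s, s' ∈ ordinates ∧ 0 < restriction d h s' := by
  have h1 : ∀ᶠ u in 𝓝 s, u ∈ ordinates ∧ 0 < restriction d h u :=
    (isOpen_ordinates.eventually_mem hs).and
      ((analyticOnNhd_restriction d h s hs).continuousAt.eventually (lt_mem_nhds hpos))
  obtain ⟨u, hu, hlt⟩ := ((h1.filter_mono nhdsWithin_le_nhds).and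
    (self_mem_nhdsWithin : Iio s ∈ 𝓝[<] s)).exists
  exact ⟨u, hlt, hu⟩

/-- Adding one monomial flips the sign at `s₀` and nowhere else among finitely many points. -/
lemma exists_monomial_flip {m : ℕ} (d : Fin m → ℝ) (h : Fin m → ℤ × ℤ) {s₀ : ℝ}
    (hs₀ : s₀ ∈ ordinates) (hpos : 0 < restriction d h s₀) (P : Finset ℝ)
    (hP : ∀ s ∈ P, s ∈ ordinates ∧ s ≠ s₀) :
    ∃ (d' : Fin (m + 1) → ℝ) (h' : Fin (m + 1) → ℤ × ℤ), restriction d' h' s₀ < 0 ∧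
      ∀ s ∈ P, ∀ ε : ℝ, |ε| = 1 → 0 < ε * restriction d h s → 0 < ε * restriction d' h' s := by
  obtain ⟨a, b, hab⟩ := exists_peaked_monomial hs₀ P hP
  set φ : ℝ → ℝ := fun s => abscissa s ^ a * s ^ b with hφ
  have hφpos : ∀ s ∈ ordinates, 0 < φ s := fun s hs =>
    mul_pos (zpow_pos (abscissa_pos s) _) (zpow_pos (mem_ordinates.1 hs).1 _)
  set C := 2 * restriction d h s₀ with hC
  have hev : ∀ᶠ N : ℕ in atTop, ∀ s ∈ P, restriction d h s ≠ 0 →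
      C * (φ s / φ s₀) ^ N < |restriction d h s| := by
    rw [eventually_all_finset]
    intro s hs
    by_cases hz : restriction d h s = 0
    · simp [hz]
    have hlim : Tendsto (fun N : ℕ => C * (φ s / φ s₀) ^ N) atTop (𝓝 (C * 0)) :=
      (tendsto_pow_atTop_nhds_zero_of_lt_one
        (div_pos (hφpos s (hP s hs).1) (hφpos s₀ hs₀)).le
        ((div_lt_one (hφpos s₀ hs₀)).2 (hab s hs))).const_mul C
    rw [mul_zero] at hlim
    exact (hlim.eventually_lt_const (abs_pos.2 hz)).mono fun _ hN _ => hN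
  obtain ⟨N, hN⟩ := hev.exists
  refine ⟨Fin.cons (-C / φ s₀ ^ N) d, Fin.cons (a * N, b * N) h, ?_⟩
  have hval : ∀ s, restriction (Fin.cons (-C / φ s₀ ^ N) d : Fin (m + 1) → ℝ)
      (Fin.cons (a * N, b * N) h : Fin (m + 1) → ℤ × ℤ) s =
      restriction d h s - C * (φ s / φ s₀) ^ N := by
    intro s
    simp only [restriction, Fin.sum_univ_succ, Fin.cons_zero, Fin.cons_succ, zpow_mul,
      zpow_natCast, hφ, div_pow, mul_pow]
    ring
  constructor
  · rw [hval, div_self (hφpos s₀ hs₀).ne', one_pow]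
    linarith
  · intro s hs ε hε hpos'
    have hne : restriction d h s ≠ 0 := fun h0 => by simp [h0] at hpos'
    have hlt := hN s hs hne
    have habs : |restriction d h s| = ε * restriction d h s := by
      rw [← abs_of_pos hpos', abs_mul, hε, one_mul]
    have hq : 0 ≤ C * (φ s / φ s₀) ^ N :=
      mul_nonneg (by linarith) (pow_pos (div_pos (hφpos s (hP s hs).1) (hφpos s₀ hs₀)) N).le
    have h1 : ε * (C * (φ s / φ s₀) ^ N) ≤ C * (φ s / φ s₀) ^ N :=
      mul_le_of_le_one_left hq (hε ▸ le_abs_self ε)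
    rw [hval, mul_sub]
    linarith

lemma Alternates.exists_add_two {m n : ℕ} (hn : 0 < n) {d : Fin m → ℝ} {h : Fin m → ℤ × ℤ}
    (H : Alternates d h n) :
    ∃ (d' : Fin (m + 1) → ℝ) (h' : Fin (m + 1) → ℤ × ℤ), Alternates d' h' (n + 2) := by
  obtain ⟨t, hmono, ht⟩ := H
  obtain ⟨s₁, hs₁lt, hs₁, hpos₁⟩ := exists_lt_restriction_pos d h (ht 0 hn).1
    (by simpa using (ht 0 hn).2)
  obtain ⟨s₀, hs₀lt, hs₀, hpos₀⟩ := exists_lt_restriction_pos d h hs₁ hpos₁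
  have hlt : ∀ i < n, s₁ < t i := by
    intro i hi
    rcases Nat.eq_zero_or_pos i with rfl | h0
    · exact hs₁lt
    · exact hs₁lt.trans (hmono 0 i h0 hi)
  obtain ⟨d', h', hneg, hP⟩ := exists_monomial_flip d h hs₁ hpos₁
    (insert s₀ ((Finset.range n).image t)) (by
      intro s hs
      rw [Finset.mem_insert, Finset.mem_image] at hs
      rcases hs with rfl | ⟨i, hi, rfl⟩
      · exact ⟨hs₀, hs₀lt.ne⟩
      · rw [Finset.mem_range] at hi
        exact ⟨(ht i hi).1, (hlt i hi).ne'⟩)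
  let t' : ℕ → ℝ := fun | 0 => s₀ | 1 => s₁ | i + 2 => t i
  refine ⟨d', h', t', ?_, ?_⟩
  · rintro (_ | _ | i) (_ | _ | j) hij hj
    · omega
    · exact hs₀lt
    · exact hs₀lt.trans (hlt j (by omega))
    · omega
    · omega
    · exact hlt j (by omega)
    · omega
    · omega
    · exact hmono i j (by omega) (by omega)
  · rintro (_ | _ | i) hi
    · refine ⟨hs₀, ?_⟩
      rw [pow_zero]
      exact hP s₀ (Finset.mem_insert_self _ _) 1 (by simp) (by simpa using hpos₀)
    · refine ⟨hs₁, ?_⟩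
      rw [zero_add, pow_one, neg_one_mul, neg_pos]
      exact hneg
    · have hi' : i < n := by omega
      refine ⟨(ht i hi').1, ?_⟩
      have hpow : (-1 : ℝ) ^ (i + 2) = (-1) ^ i := by rw [pow_add]; norm_num
      change 0 < (-1) ^ (i + 2) * restriction d' h' (t i)
      rw [hpow]
      exact hP (t i) (Finset.mem_insert_of_mem (Finset.mem_image_of_mem t (Finset.mem_range.2 hi')))
        _ (by simp) (ht i hi').2

lemma abscissa_bounds {s l u : ℝ} (hs : s ∈ ordinates) (hu : 0 ≤ u)
    (hl' : l ^ 6 < s - 44 / 31 * s ^ 3) (hu' : s - 44 / 31 * s ^ 3 < u ^ 6) :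
    l < abscissa s ∧ abscissa s < u := by
  rw [← abscissa_pow_six hs] at hl' hu'
  exact ⟨lt_of_pow_lt_pow_left₀ 6 (abscissa_pos s).le hl', lt_of_pow_lt_pow_left₀ 6 hu hu'⟩

/-- The second equation of the system of Dickenstein, Rojas, Rusek and Shih. -/
lemma alternates_trinomial :
    Alternates ![1, -1, -(44 / 31)] ![(1, 0), (0, 6), (3, 0)] 6 := by
  have hval : ∀ s, restriction ![1, -1, -(44 / 31)] ![(1, 0), (0, 6), (3, 0)] s =
      abscissa s - s ^ 6 - 44 / 31 * abscissa s ^ 3 := by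
    intro s
    simp only [restriction, Fin.sum_univ_three, Matrix.cons_val_zero, Matrix.cons_val_one,
      Matrix.cons_val, zpow_ofNat]
    ring
  have hpos : ∀ s l u : ℝ, 0 < s → 44 / 31 * s ^ 2 < 1 → 0 ≤ l → 0 ≤ u →
      l ^ 6 < s - 44 / 31 * s ^ 3 → s - 44 / 31 * s ^ 3 < u ^ 6 →
      0 < l - s ^ 6 - 44 / 31 * u ^ 3 →
      s ∈ ordinates ∧
        0 < restriction ![1, -1, -(44 / 31)] ![(1, 0), (0, 6), (3, 0)] s := by
    intro s l u h0 h1 hl hu hl' hu' hlu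
    have hs := mem_ordinates.2 ⟨h0, h1⟩
    obtain ⟨hlx, hxu⟩ := abscissa_bounds hs hu hl' hu'
    have := pow_lt_pow_left₀ hxu (abscissa_pos s).le three_ne_zero
    rw [hval]
    exact ⟨hs, by linarith⟩
  have hneg : ∀ s l u : ℝ, 0 < s → 44 / 31 * s ^ 2 < 1 → 0 ≤ l → 0 ≤ u →
      l ^ 6 < s - 44 / 31 * s ^ 3 → s - 44 / 31 * s ^ 3 < u ^ 6 →
      u - s ^ 6 - 44 / 31 * l ^ 3 < 0 →
      s ∈ ordinates ∧
        restriction ![1, -1, -(44 / 31)] ![(1, 0), (0, 6), (3, 0)] s < 0 := by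
    intro s l u h0 h1 hl hu hl' hu' hlu
    have hs := mem_ordinates.2 ⟨h0, h1⟩
    obtain ⟨hlx, hxu⟩ := abscissa_bounds hs hu hl' hu'
    have := pow_lt_pow_left₀ hlx hl three_ne_zero
    rw [hval]
    exact ⟨hs, by linarith⟩
  have h0 := hpos (5 / 10) (82814500 / 100000000) (82814501 / 100000000)
    (by norm_num) (by norm_num) (by norm_num) (by norm_num) (by norm_num) (by norm_num)
    (by norm_num)
  have h1 := hneg (65 / 100) (79901311 / 100000000) (79901312 / 100000000)
    (by norm_num) (by norm_num) (by norm_num) (by norm_num) (by norm_num) (by norm_num)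
    (by norm_num)
  have h2 := hpos (73 / 100) (74990749 / 100000000) (74990750 / 100000000)
    (by norm_num) (by norm_num) (by norm_num) (by norm_num) (by norm_num) (by norm_num)
    (by norm_num)
  have h3 := hneg (75 / 100) (72989983 / 100000000) (72989984 / 100000000)
    (by norm_num) (by norm_num) (by norm_num) (by norm_num) (by norm_num) (by norm_num)
    (by norm_num)
  have h4 := hpos (80 / 100) (64690589 / 100000000) (64690590 / 100000000)
    (by norm_num) (by norm_num) (by norm_num) (by norm_num) (by norm_num) (by norm_num)
    (by norm_num)
  have h5 := hneg (83 / 100) (51395631 / 100000000) (51395632 / 100000000)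
    (by norm_num) (by norm_num) (by norm_num) (by norm_num) (by norm_num) (by norm_num)
    (by norm_num)
  let t : ℕ → ℝ := fun
    | 0 => 5 / 10 | 1 => 65 / 100 | 2 => 73 / 100 | 3 => 75 / 100 | 4 => 80 / 100 | _ => 83 / 100
  refine ⟨t, ?_, ?_⟩
  · intro i j hij hj
    interval_cases j <;> interval_cases i <;> norm_num [t]
  · intro i hi
    interval_cases i
    · exact ⟨h0.1, by simpa [t] using h0.2⟩
    · exact ⟨h1.1, by simpa [t] using h1.2⟩
    · exact ⟨h2.1, by simpa [t] using h2.2⟩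
    · exact ⟨h3.1, by
        rw [show (-1 : ℝ) ^ 3 = -1 by norm_num, neg_one_mul, neg_pos]; exact h3.2⟩
    · exact ⟨h4.1, by
        rw [show (-1 : ℝ) ^ 4 = 1 by norm_num, one_mul]; exact h4.2⟩
    · exact ⟨h5.1, by
        rw [show (-1 : ℝ) ^ 5 = -1 by norm_num, neg_one_mul, neg_pos]; exact h5.2⟩

lemma exists_alternates {m : ℕ} (hm : 3 ≤ m) :
    ∃ (d : Fin m → ℝ) (h : Fin m → ℤ × ℤ), Alternates d h (2 * m) := by
  induction m, hm using Nat.le_induction with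
  | base => exact ⟨_, _, alternates_trinomial⟩
  | succ m hm ih =>
    obtain ⟨d, h, H⟩ := ih
    exact H.exists_add_two (Nat.mul_pos two_pos (three_pos.trans_le hm))

lemma Alternates.exists_zeros {m n : ℕ} {d : Fin m → ℝ} {h : Fin m → ℤ × ℤ}
    (H : Alternates d h (n + 1)) :
    ∃ z : Fin n → ℝ, StrictMono z ∧ ∀ i, z i ∈ ordinates ∧ restriction d h (z i) = 0 := by
  obtain ⟨t, hmono, ht⟩ := H
  have hex : ∀ i : Fin n, ∃ z ∈ Ioo (t i) (t (i + 1)), restriction d h z = 0 := by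
    intro i
    obtain ⟨hI, hi⟩ := ht i (by omega)
    obtain ⟨hJ, hj⟩ := ht (i + 1) (by omega)
    have hle := (hmono i (i + 1) (by omega) (by omega)).le
    have hcont : ContinuousOn (restriction d h) (Icc (t i) (t (i + 1))) :=
      (analyticOnNhd_restriction d h).continuousOn.mono (ordConnected_Ioo.out hI hJ)
    rw [pow_succ] at hj
    rcases neg_one_pow_eq_or ℝ (i : ℕ) with hs | hs <;> rw [hs] at hi hj
    · exact intermediate_value_Ioo' hle hcont ⟨by linarith, by linarith⟩
    · exact intermediate_value_Ioo hle hcont ⟨by linarith, by linarith⟩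
  choose z hz hz0 using hex
  refine ⟨z, fun i j hij => ?_, fun i => ⟨?_, hz0 i⟩⟩
  · have hle : t (i + 1) ≤ t j := by
      rcases Nat.eq_or_lt_of_le (Nat.succ_le_of_lt (Fin.lt_def.1 hij)) with h' | h'
      · exact (congrArg t h').le
      · exact (hmono _ _ h' (by omega)).le
    exact (hz i).2.trans_le (hle.trans (hz j).1.le)
  · exact ordConnected_Ioo.out (ht i (by omega)).1 (ht (i + 1) (by omega)).1
      (Ioo_subset_Icc_self (hz i))

lemma Alternates.eventually_ne_zero {m n : ℕ} (hn : 0 < n) {d : Fin m → ℝ} {h : Fin m → ℤ × ℤ}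
    (H : Alternates d h n) {s : ℝ} (hs : s ∈ ordinates) :
    ∀ᶠ u in 𝓝[≠] s, restriction d h u ≠ 0 := by
  obtain ⟨t, -, ht⟩ := H
  by_contra hfreq
  have hz := (analyticOnNhd_restriction d h).eqOn_zero_of_preconnected_of_frequently_eq_zero
    isPreconnected_Ioo hs hfreq
  obtain ⟨h0, h1⟩ := ht 0 hn
  rw [hz h0] at h1
  simp at h1

lemma Alternates.exists_isolated {m n : ℕ} {d : Fin m → ℝ} {h : Fin m → ℤ × ℤ}
    (H : Alternates d h (n + 1)) {S : Set (ℝ × ℝ)}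
    (hS : ∀ p, p ∈ S ↔ p.2 ∈ ordinates ∧ p.1 = abscissa p.2 ∧ restriction d h p.2 = 0) :
    ∃ T : Set (ℝ × ℝ), T.Finite ∧ n ≤ T.ncard ∧
      ∀ p ∈ T, p ∈ S ∧ ∃ U : Set (ℝ × ℝ), IsOpen U ∧ p ∈ U ∧ U ∩ S = {p} := by
  obtain ⟨z, hzmono, hz⟩ := H.exists_zeros
  have hinj : Function.Injective fun i => (abscissa (z i), z i) :=
    fun i j hij => hzmono.injective (Prod.ext_iff.1 hij).2
  refine ⟨range fun i => (abscissa (z i), z i), finite_range _, ?_, ?_⟩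
  · rw [← image_univ, ncard_image_of_injective _ hinj, ncard_univ, Nat.card_fin]
  · rintro _ ⟨i, rfl⟩
    obtain ⟨hzI, hz0⟩ := hz i
    have hmem : (abscissa (z i), z i) ∈ S := (hS _).2 ⟨hzI, rfl, hz0⟩
    refine ⟨hmem, ?_⟩
    obtain ⟨V, hV, hVo, hzV⟩ := eventually_nhds_iff.1
      (eventually_nhdsWithin_iff.1 (H.eventually_ne_zero n.succ_pos hzI))
    refine ⟨Prod.snd ⁻¹' V, hVo.preimage continuous_snd, hzV, ?_⟩
    ext p
    constructor
    · rintro ⟨hpV, hpS⟩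
      obtain ⟨-, hp1, hp0⟩ := (hS p).1 hpS
      have hp2 : p.2 = z i := by
        by_contra hne
        exact hV p.2 hpV hne hp0
      exact Prod.ext (by rw [hp1, hp2]) hp2
    · rintro rfl
      exact ⟨hzV, hmem⟩

end TrinomialCurve

open TrinomialCurve

theorem stmt1 (m : ℕ) (hm : 3 ≤ m) :
    ∃ (c : Fin 3 → ℝ) (e : Fin 3 → ℤ × ℤ) (d : Fin m → ℝ) (h : Fin m → ℤ × ℤ),
      letI f : ℝ × ℝ → ℝ := fun p => ∑ i, c i * p.1 ^ (e i).1 * p.2 ^ (e i).2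
      letI g : ℝ × ℝ → ℝ := fun p => ∑ i, d i * p.1 ^ (h i).1 * p.2 ^ (h i).2
      letI S : Set (ℝ × ℝ) := {p | 0 < p.1 ∧ 0 < p.2 ∧ f p = 0 ∧ g p = 0}
      ∃ T : Set (ℝ × ℝ), T.Finite ∧ 2 * m - 1 ≤ T.ncard ∧
        ∀ p ∈ T, p ∈ S ∧ ∃ U : Set (ℝ × ℝ), IsOpen U ∧ p ∈ U ∧ U ∩ S = {p} := by
  obtain ⟨d, h, H⟩ := exists_alternates hm
  refine ⟨![1, 44 / 31, -1], ![(6, 0), (0, 3), (0, 1)], d, h, ?_⟩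
  have H' : Alternates d h (2 * m - 1 + 1) := by rwa [Nat.sub_add_cancel (by omega)]
  refine H'.exists_isolated ?_
  rintro ⟨x, y⟩
  have hf : ∑ i, (![1, 44 / 31, -1] : Fin 3 → ℝ) i *
      x ^ ((![(6, 0), (0, 3), (0, 1)] : Fin 3 → ℤ × ℤ) i).1 *
      y ^ ((![(6, 0), (0, 3), (0, 1)] : Fin 3 → ℤ × ℤ) i).2 = x ^ 6 + 44 / 31 * y ^ 3 - y := by
    simp only [Fin.sum_univ_three, Matrix.cons_val_zero, Matrix.cons_val_one,
      Matrix.cons_val, zpow_ofNat]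
    ring
  constructor
  · rintro ⟨hx, hy, h1, h2⟩
    obtain ⟨hy', hx'⟩ := (mem_curve_iff hx hy).1 (sub_eq_zero.1 (hf.symm.trans h1))
    obtain rfl : x = abscissa y := hx'
    exact ⟨hy', rfl, h2⟩
  · rintro ⟨hy', hx', h2⟩
    obtain rfl : x = abscissa y := hx'
    have hy := (mem_ordinates.1 hy').1
    exact ⟨abscissa_pos y, hy,
      hf.trans (sub_eq_zero.2 ((mem_curve_iff (abscissa_pos y) hy).2 ⟨hy', rfl⟩)), h2⟩
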